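/- arXiv:2402.02451 — 2 statements merged into one kernel-verified Lean document; each statement's English description precedes it below -/
import Mathlib

section
/- Let μ, ν ≥ 0, T > 0, and let v, h : [0,T]×ℝ³ → ℝ³ and P : [0,T]×ℝ³ → ℝ be jointly smooth, with the supports of v(t,·) and h(t,·) contained in a fixed compact set K ⊂ ℝ³ for all t ∈ [0,T]. Suppose that for each t, v(t,·) and h(t,·) are divergence-free and that the Hall-MHD system holds on [0,T]×ℝ³: ∂_t v + (v·∇)v + ∇P − μΔv = (h·∇)h and ∂_t h + (v·∇)h + ∇×((∇×h)×h) − νΔh = (h·∇)v. Then for all t ∈ [0,T]: ∫_{ℝ³}(|v(t,x)|² + |h(t,x)|²) dx ≤ ∫_{ℝ³}(|v(0,x)|² + |h(0,x)|²) dx. -/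
open MeasureTheory

noncomputable section

abbrev R3 : Type := Fin 3 → ℝ

/-- cylindrical radius `r(x) = √(x₁² + x₂²)` -/
def rr (x : R3) : ℝ := Real.sqrt (x 0 ^ 2 + x 1 ^ 2)

/-- the region off the symmetry axis -/
def U : Set R3 := {x | 0 < rr x}

/-- partial derivative in coordinate direction `i` -/
def pd (i : Fin 3) (u : R3 → ℝ) : R3 → ℝ := fun x => fderiv ℝ u x (Pi.single i 1)

/-- angular derivative `∂_θ u = x₁ ∂₂ u − x₂ ∂₁ u` -/
def dTheta (u : R3 → ℝ) : R3 → ℝ := fun x => x 0 * pd 1 u x - x 1 * pd 0 u x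

/-- radial derivative `∂_r u = (x₁ ∂₁ u + x₂ ∂₂ u)/r` -/
def dR (u : R3 → ℝ) : R3 → ℝ := fun x => (x 0 * pd 0 u x + x 1 * pd 1 u x) / rr x

/-- vertical derivative `∂_z` -/
def dZ (u : R3 → ℝ) : R3 → ℝ := pd 2 u

/-- the operator `(1/r)∂_r` -/
def dRr (u : R3 → ℝ) : R3 → ℝ := fun x => dR u x / rr x

/-- axisymmetric: `∂_θ f = 0` on `U` -/
def axisym (f : R3 → ℝ) : Prop := ∀ x ∈ U, dTheta f x = 0

/-- radial unit vector -/
def er (x : R3) : R3 := ![x 0 / rr x, x 1 / rr x, 0]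
/-- azimuthal unit vector -/
def etheta (x : R3) : R3 := ![-(x 1) / rr x, x 0 / rr x, 0]
/-- vertical unit vector -/
def ez : R3 := ![0, 0, 1]

/-- the curl of a vector field -/
def curl (F : R3 → R3) (x : R3) : R3 :=
  ![pd 1 (fun y => F y 2) x - pd 2 (fun y => F y 1) x,
    pd 2 (fun y => F y 0) x - pd 0 (fun y => F y 2) x,
    pd 0 (fun y => F y 1) x - pd 1 (fun y => F y 0) x]

/-- the cross product in `ℝ³` -/
def cross (a b : R3) : R3 :=
  ![a 1 * b 2 - a 2 * b 1, a 2 * b 0 - a 0 * b 2, a 0 * b 1 - a 1 * b 0]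

lemma pd_add' (j : Fin 3) (f g : R3 → ℝ) (x : R3) (hf : DifferentiableAt ℝ f x)
    (hg : DifferentiableAt ℝ g x) : pd j (fun y => f y + g y) x = pd j f x + pd j g x := by
  unfold pd; rw [fderiv_fun_add hf hg]; rfl

lemma pd_sub' (j : Fin 3) (f g : R3 → ℝ) (x : R3) (hf : DifferentiableAt ℝ f x)
    (hg : DifferentiableAt ℝ g x) : pd j (fun y => f y - g y) x = pd j f x - pd j g x := by
  unfold pd; rw [fderiv_fun_sub hf hg]; rfl

lemma pd_mul' (j : Fin 3) (f g : R3 → ℝ) (x : R3) (hf : DifferentiableAt ℝ f x)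
    (hg : DifferentiableAt ℝ g x) :
    pd j (fun y => f y * g y) x = f x * pd j g x + g x * pd j f x := by
  unfold pd; rw [fderiv_fun_mul hf hg]; simp

lemma pd_cmul' (j : Fin 3) (c : ℝ) (f : R3 → ℝ) (x : R3) (hf : DifferentiableAt ℝ f x) :
    pd j (fun y => c * f y) x = c * pd j f x := by
  unfold pd; rw [fderiv_const_mul hf]; simp

lemma contDiff_pd (j : Fin 3) (f : R3 → ℝ) (hf : ContDiff ℝ (⊤ : ℕ∞) f) :
    ContDiff ℝ (⊤ : ℕ∞) (pd j f) := by
  unfold pd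
  exact (hf.fderiv_right (m := (⊤ : ℕ∞)) (by simp)).clm_apply contDiff_const

lemma integral_pd (j : Fin 3) (f : R3 → ℝ) (hf : ContDiff ℝ (⊤ : ℕ∞) f) (K : Set R3)
    (hK : IsCompact K) (h0 : ∀ x ∉ K, f x = 0) :
    Integrable (pd j f) ∧ ∫ x, pd j f x = 0 := by
  have hs : HasCompactSupport f := HasCompactSupport.intro hK h0
  have hi : Integrable (pd j f) := by
    refine (contDiff_pd j f hf).continuous.integrable_of_hasCompactSupport ?_
    exact (hs.fderiv_apply (𝕜 := ℝ) _)
  refine ⟨hi, ?_⟩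
  have hfi : Integrable f := hf.continuous.integrable_of_hasCompactSupport hs
  have := integral_mul_fderiv_eq_neg_fderiv_mul_of_integrable (μ := (volume : Measure R3))
    (f := fun _ : R3 => (1 : ℝ)) (g := f) (v := Pi.single j 1)
    (by simp) (by simpa [pd] using (show Integrable (fun x => pd j f x) from hi)) (by simpa using hfi)
    (fun x _ => by fun_prop) (fun x _ => (hf.differentiable (by simp)) x)
  simpa [pd] using this

lemma core (μ ν : ℝ) (hμ : 0 ≤ μ) (hν : 0 ≤ ν) (V H G A B : Fin 3 → R3 → ℝ) (P : R3 → ℝ)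
    (hV : ∀ i, ContDiff ℝ (⊤ : ℕ∞) (V i)) (hH : ∀ i, ContDiff ℝ (⊤ : ℕ∞) (H i))
    (hG : ∀ i, ContDiff ℝ (⊤ : ℕ∞) (G i)) (hP : ContDiff ℝ (⊤ : ℕ∞) P)
    (K : Set R3) (hK : IsCompact K)
    (hV0 : ∀ i, ∀ x ∉ K, V i x = 0) (hH0 : ∀ i, ∀ x ∉ K, H i x = 0)
    (hdV : ∀ x, pd 0 (V 0) x + pd 1 (V 1) x + pd 2 (V 2) x = 0)
    (hdH : ∀ x, pd 0 (H 0) x + pd 1 (H 1) x + pd 2 (H 2) x = 0)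
    (hGJ : ∀ x, G 0 x * (pd 1 (H 2) x - pd 2 (H 1) x) + G 1 x * (pd 2 (H 0) x - pd 0 (H 2) x)
      + G 2 x * (pd 0 (H 1) x - pd 1 (H 0) x) = 0)
    (hA : ∀ x i, A i x + (∑ j, V j x * pd j (V i) x) + pd i P x - μ * (∑ j, pd j (pd j (V i)) x)
      = ∑ j, H j x * pd j (H i) x)
    (hB0 : ∀ x, B 0 x + (∑ j, V j x * pd j (H 0) x) + (pd 1 (G 2) x - pd 2 (G 1) x)
      - ν * (∑ j, pd j (pd j (H 0)) x) = ∑ j, H j x * pd j (V 0) x)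
    (hB1 : ∀ x, B 1 x + (∑ j, V j x * pd j (H 1) x) + (pd 2 (G 0) x - pd 0 (G 2) x)
      - ν * (∑ j, pd j (pd j (H 1)) x) = ∑ j, H j x * pd j (V 1) x)
    (hB2 : ∀ x, B 2 x + (∑ j, V j x * pd j (H 2) x) + (pd 0 (G 1) x - pd 1 (G 0) x)
      - ν * (∑ j, pd j (pd j (H 2)) x) = ∑ j, H j x * pd j (V 2) x) :
    ∫ x, ((∑ i, V i x * A i x) + ∑ i, H i x * B i x) ≤ 0 := by
  have hpV : ∀ i j, ContDiff ℝ (⊤ : ℕ∞) (pd j (V i)) := fun i j => contDiff_pd j _ (hV i)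
  have hpH : ∀ i j, ContDiff ℝ (⊤ : ℕ∞) (pd j (H i)) := fun i j => contDiff_pd j _ (hH i)
  have dV : ∀ i, Differentiable ℝ (V i) := fun i => (hV i).differentiable (by simp)
  have dH : ∀ i, Differentiable ℝ (H i) := fun i => (hH i).differentiable (by simp)
  have dG : ∀ i, Differentiable ℝ (G i) := fun i => (hG i).differentiable (by simp)
  have dP : Differentiable ℝ P := hP.differentiable (by simp)
  have dpV : ∀ i j, Differentiable ℝ (pd j (V i)) := fun i j => (hpV i j).differentiable (by simp)
  have dpH : ∀ i j, Differentiable ℝ (pd j (H i)) := fun i j => (hpH i j).differentiable (by simp)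
  let F : Fin 3 → R3 → ℝ := fun j y =>
    (μ * (V 0 y * pd j (V 0) y + V 1 y * pd j (V 1) y + V 2 y * pd j (V 2) y)
    + ν * (H 0 y * pd j (H 0) y + H 1 y * pd j (H 1) y + H 2 y * pd j (H 2) y))
    + (V 0 y * H 0 y + V 1 y * H 1 y + V 2 y * H 2 y) * H j y
    - V j y * (P y + (1/2) * ((V 0 y * V 0 y + V 1 y * V 1 y + V 2 y * V 2 y)
        + (H 0 y * H 0 y + H 1 y * H 1 y + H 2 y * H 2 y)))
  let C0 : R3 → ℝ := fun y => G 1 y * H 2 y - G 2 y * H 1 y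
  let C1 : R3 → ℝ := fun y => G 2 y * H 0 y - G 0 y * H 2 y
  let C2 : R3 → ℝ := fun y => G 0 y * H 1 y - G 1 y * H 0 y
  have iF : ∀ j, Integrable (pd j (F j)) ∧ ∫ x, pd j (F j) x = 0 := fun j =>
    integral_pd j (F j) (by fun_prop) K hK (fun x hx => by simp [F, hV0 _ x hx, hH0 _ x hx])
  have i0 := integral_pd 0 C0 (by fun_prop) K hK (fun x hx => by simp [C0, hH0 _ x hx])
  have i1 := integral_pd 1 C1 (by fun_prop) K hK (fun x hx => by simp [C1, hH0 _ x hx])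
  have i2 := integral_pd 2 C2 (by fun_prop) K hK (fun x hx => by simp [C2, hH0 _ x hx])
  have eF : ∀ j x, pd j (F j) x =
    (μ * (V 0 x * pd j (pd j (V 0)) x + V 1 x * pd j (pd j (V 1)) x + V 2 x * pd j (pd j (V 2)) x
      + (pd j (V 0) x ^ 2 + pd j (V 1) x ^ 2 + pd j (V 2) x ^ 2))
    + ν * (H 0 x * pd j (pd j (H 0)) x + H 1 x * pd j (pd j (H 1)) x + H 2 x * pd j (pd j (H 2)) x
      + (pd j (H 0) x ^ 2 + pd j (H 1) x ^ 2 + pd j (H 2) x ^ 2)))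
    + ((V 0 x * H 0 x + V 1 x * H 1 x + V 2 x * H 2 x) * pd j (H j) x
      + H j x * (V 0 x * pd j (H 0) x + H 0 x * pd j (V 0) x + V 1 x * pd j (H 1) x
        + H 1 x * pd j (V 1) x + V 2 x * pd j (H 2) x + H 2 x * pd j (V 2) x))
    - (V j x * (pd j P x + (V 0 x * pd j (V 0) x + V 1 x * pd j (V 1) x + V 2 x * pd j (V 2) x
        + H 0 x * pd j (H 0) x + H 1 x * pd j (H 1) x + H 2 x * pd j (H 2) x))
      + (P x + (1/2) * ((V 0 x * V 0 x + V 1 x * V 1 x + V 2 x * V 2 x)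
        + (H 0 x * H 0 x + H 1 x * H 1 x + H 2 x * H 2 x))) * pd j (V j) x) := by
    intro j x
    simp (disch := fun_prop) only [F, pd_sub', pd_add', pd_cmul', pd_mul']
    ring
  have e0 : ∀ x, pd 0 C0 x = G 1 x * pd 0 (H 2) x + H 2 x * pd 0 (G 1) x
      - (G 2 x * pd 0 (H 1) x + H 1 x * pd 0 (G 2) x) := by
    intro x
    simp (disch := fun_prop) only [C0, pd_sub', pd_mul']
  have e1 : ∀ x, pd 1 C1 x = G 2 x * pd 1 (H 0) x + H 0 x * pd 1 (G 2) x
      - (G 0 x * pd 1 (H 2) x + H 2 x * pd 1 (G 0) x) := by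
    intro x
    simp (disch := fun_prop) only [C1, pd_sub', pd_mul']
  have e2 : ∀ x, pd 2 C2 x = G 0 x * pd 2 (H 1) x + H 1 x * pd 2 (G 0) x
      - (G 1 x * pd 2 (H 0) x + H 0 x * pd 2 (G 1) x) := by
    intro x
    simp (disch := fun_prop) only [C2, pd_sub', pd_mul']
  let D : R3 → ℝ := fun x => (pd 0 (F 0) x + pd 1 (F 1) x + pd 2 (F 2) x)
    - (pd 0 C0 x + pd 1 C1 x + pd 2 C2 x)
  have hDi1 := ((iF 0).1.add (iF 1).1).add (iF 2).1
  have hDi2 := (i0.1.add i1.1).add i2.1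
  have hDi : Integrable D := hDi1.sub hDi2
  have hD0 : ∫ x, D x = 0 := by
    have a1 : ∫ x, D x = (∫ x, (pd 0 (F 0) x + pd 1 (F 1) x + pd 2 (F 2) x))
      - ∫ x, (pd 0 C0 x + pd 1 C1 x + pd 2 C2 x) := integral_sub hDi1 hDi2
    have a2 : ∫ x, (pd 0 (F 0) x + pd 1 (F 1) x + pd 2 (F 2) x)
      = (∫ x, (pd 0 (F 0) x + pd 1 (F 1) x)) + ∫ x, pd 2 (F 2) x :=
      integral_add ((iF 0).1.add (iF 1).1) (iF 2).1
    have a3 : ∫ x, (pd 0 C0 x + pd 1 C1 x + pd 2 C2 x)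
      = (∫ x, (pd 0 C0 x + pd 1 C1 x)) + ∫ x, pd 2 C2 x :=
      integral_add (i0.1.add i1.1) i2.1
    rw [a1, a2, a3, integral_add (iF 0).1 (iF 1).1, integral_add i0.1 i1.1,
      (iF 0).2, (iF 1).2, (iF 2).2, i0.2, i1.2, i2.2]
    norm_num
  by_cases hint : Integrable (fun x => (∑ i, V i x * A i x) + ∑ i, H i x * B i x)
  swap
  · rw [integral_undef hint]
  rw [← hD0]
  refine integral_mono hint hDi (fun x => ?_)
  have key : D x - ((∑ i, V i x * A i x) + ∑ i, H i x * B i x)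
      = μ * (∑ i, ∑ j, pd j (V i) x ^ 2) + ν * (∑ i, ∑ j, pd j (H i) x ^ 2) := by
    have hA0 := hA x 0
    have hA1 := hA x 1
    have hA2 := hA x 2
    have hB0 := hB0 x
    have hB1 := hB1 x
    have hB2 := hB2 x
    simp only [D, eF, e0, e1, e2, Fin.sum_univ_three] at *
    linear_combination (-(V 0 x)) * hA0 - V 1 x * hA1 - V 2 x * hA2
      - H 0 x * hB0 - H 1 x * hB1 - H 2 x * hB2
      + (V 0 x * H 0 x + V 1 x * H 1 x + V 2 x * H 2 x) * hdH x
      - (P x + (1/2) * ((V 0 x * V 0 x + V 1 x * V 1 x + V 2 x * V 2 x)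
        + (H 0 x * H 0 x + H 1 x * H 1 x + H 2 x * H 2 x))) * hdV x
      + hGJ x
  have : 0 ≤ μ * (∑ i, ∑ j, pd j (V i) x ^ 2) + ν * (∑ i, ∑ j, pd j (H i) x ^ 2) := by
    positivity
  show _ ≤ D x
  linarith

lemma time_lemma (T : ℝ) (f : ℝ → R3 → ℝ)
    (hf : ContDiff ℝ (⊤ : ℕ∞) (fun p : ℝ × R3 => f p.1 p.2)) (K : Set R3) (hK : IsCompact K)
    (h0 : ∀ t ∈ Set.Icc (0 : ℝ) T, ∀ x ∉ K, f t x = 0)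
    (hd : ∀ t ∈ Set.Icc (0 : ℝ) T, ∫ x in K, deriv (fun s => f s x) t ≤ 0) :
    ∀ t ∈ Set.Icc (0 : ℝ) T, ∫ x, f t x ≤ ∫ x, f 0 x := by
  intro t ht
  let g : ℝ → R3 → ℝ := fun s x => deriv (fun s => f s x) s
  have hder : ∀ s x, HasDerivAt (fun s => f s x) (g s x) s := by
    intro s x
    apply DifferentiableAt.hasDerivAt
    have : Differentiable ℝ (fun p : ℝ × R3 => f p.1 p.2) := hf.differentiable (by simp)
    exact (this.comp (f := fun s : ℝ => (s, x)) (by fun_prop)) s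
  have hg : Continuous (Function.uncurry g) := by
    have e : Function.uncurry g
        = fun p : ℝ × R3 => fderiv ℝ (fun p : ℝ × R3 => f p.1 p.2) p (1, 0) := by
      funext ⟨s, x⟩
      have h1 : HasFDerivAt (fun p : ℝ × R3 => f p.1 p.2) _ (s, x) :=
        ((hf.differentiable (by simp)) (s, x)).hasFDerivAt
      have h2 : HasDerivAt (fun s : ℝ => (s, x)) ((1 : ℝ), (0 : R3)) s :=
        (hasDerivAt_id s).prodMk (hasDerivAt_const s x)
      exact (h1.comp_hasDerivAt s h2).deriv
    rw [e]
    exact ((hf.fderiv_right (m := (⊤ : ℕ∞)) (by simp)).clm_apply contDiff_const).continuous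
  have hc : ∀ s, Continuous (f s) := fun s =>
    hf.continuous.comp (f := fun x : R3 => (s, x)) (by fun_prop)
  have hT0 : (0 : ℝ) ∈ Set.Icc (0 : ℝ) T := ⟨le_rfl, ht.1.trans ht.2⟩
  rw [← setIntegral_eq_integral_of_forall_compl_eq_zero (h0 t ht),
    ← setIntegral_eq_integral_of_forall_compl_eq_zero (h0 0 hT0)]
  have hsub : (∫ x in K, f t x) - ∫ x in K, f 0 x = ∫ x in K, ∫ s in (0:ℝ)..t, g s x := by
    rw [← integral_sub ((hc t).continuousOn.integrableOn_compact hK)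
      ((hc 0).continuousOn.integrableOn_compact hK)]
    refine integral_congr_ae (Filter.Eventually.of_forall fun x => ?_)
    have hgx : Continuous (fun s => g s x) := hg.comp (f := fun s : ℝ => (s, x)) (by fun_prop)
    exact (intervalIntegral.integral_eq_sub_of_hasDerivAt (fun s _ => hder s x)
      (hgx.intervalIntegrable _ _)).symm
  have hI : Integrable (Function.uncurry g)
      ((volume.restrict (Set.uIoc 0 t)).prod (volume.restrict K)) := by
    rw [Measure.prod_restrict, ← Measure.volume_eq_prod]
    have : IntegrableOn (Function.uncurry g) (Set.uIcc 0 t ×ˢ K) :=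
      hg.continuousOn.integrableOn_compact (isCompact_uIcc.prod hK)
    exact this.mono_set (Set.prod_mono Set.uIoc_subset_uIcc le_rfl)
  rw [← intervalIntegral_integral_swap hI] at hsub
  have hle : ∫ s in (0:ℝ)..t, ∫ x in K, g s x ≤ 0 := by
    rw [intervalIntegral.integral_of_le ht.1]
    refine setIntegral_nonpos measurableSet_Ioc (fun s hs => hd s ⟨hs.1.le, hs.2.trans ht.2⟩)
  linarith

/-- fundamental energy inequality for the Hall-MHD system. -/
theorem stmt_13 (μ ν : ℝ) (hμ : 0 ≤ μ) (hν : 0 ≤ ν) (T : ℝ) (hT : 0 < T)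
    (v h : ℝ → R3 → R3) (P : ℝ → R3 → ℝ)
    (hv : ContDiff ℝ (⊤ : ℕ∞) (fun p : ℝ × R3 => v p.1 p.2))
    (hh : ContDiff ℝ (⊤ : ℕ∞) (fun p : ℝ × R3 => h p.1 p.2))
    (hP : ContDiff ℝ (⊤ : ℕ∞) (fun p : ℝ × R3 => P p.1 p.2))
    (K : Set R3) (hK : IsCompact K)
    (hsuppv : ∀ t ∈ Set.Icc (0 : ℝ) T, ∀ x ∉ K, v t x = 0)
    (hsupph : ∀ t ∈ Set.Icc (0 : ℝ) T, ∀ x ∉ K, h t x = 0)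
    (hdivv : ∀ t ∈ Set.Icc (0 : ℝ) T, ∀ x : R3,
      (∑ j : Fin 3, pd j (fun y => v t y j) x) = 0)
    (hdivh : ∀ t ∈ Set.Icc (0 : ℝ) T, ∀ x : R3,
      (∑ j : Fin 3, pd j (fun y => h t y j) x) = 0)
    (heqv : ∀ t ∈ Set.Icc (0 : ℝ) T, ∀ x : R3, ∀ i : Fin 3,
      deriv (fun s => v s x i) t
        + (∑ j : Fin 3, v t x j * pd j (fun y => v t y i) x)
        + pd i (P t) x
        - μ * (∑ j : Fin 3, pd j (pd j (fun y => v t y i)) x)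
        = ∑ j : Fin 3, h t x j * pd j (fun y => h t y i) x)
    (heqh : ∀ t ∈ Set.Icc (0 : ℝ) T, ∀ x : R3, ∀ i : Fin 3,
      deriv (fun s => h s x i) t
        + (∑ j : Fin 3, v t x j * pd j (fun y => h t y i) x)
        + curl (fun y => cross (curl (h t) y) (h t y)) x i
        - ν * (∑ j : Fin 3, pd j (pd j (fun y => h t y i)) x)
        = ∑ j : Fin 3, h t x j * pd j (fun y => v t y i) x) :
    ∀ t ∈ Set.Icc (0 : ℝ) T,
      (∫ x : R3, ((∑ i : Fin 3, (v t x i) ^ 2) + ∑ i : Fin 3, (h t x i) ^ 2))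
        ≤ ∫ x : R3, ((∑ i : Fin 3, (v 0 x i) ^ 2) + ∑ i : Fin 3, (h 0 x i) ^ 2) := by
  
  have slv : ∀ t i, ContDiff ℝ (⊤ : ℕ∞) (fun y => v t y i) := fun t i =>
    (contDiff_pi.1 hv i).comp (f := fun x : R3 => (t, x)) (by fun_prop)
  have slh : ∀ t i, ContDiff ℝ (⊤ : ℕ∞) (fun y => h t y i) := fun t i =>
    (contDiff_pi.1 hh i).comp (f := fun x : R3 => (t, x)) (by fun_prop)
  have slP : ∀ t, ContDiff ℝ (⊤ : ℕ∞) (P t) := fun t =>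
    hP.comp (f := fun x : R3 => (t, x)) (by fun_prop)
  have tv : ∀ x i, Differentiable ℝ (fun s => v s x i) := fun x i =>
    ((contDiff_pi.1 hv i).comp (f := fun s : ℝ => (s, x)) (by fun_prop)).differentiable (by simp)
  have th : ∀ x i, Differentiable ℝ (fun s => h s x i) := fun x i =>
    ((contDiff_pi.1 hh i).comp (f := fun s : ℝ => (s, x)) (by fun_prop)).differentiable (by simp)
  have hvi := contDiff_pi.1 hv
  have hhi := contDiff_pi.1 hh
  refine time_lemma T (fun t x => (∑ i : Fin 3, (v t x i) ^ 2) + ∑ i : Fin 3, (h t x i) ^ 2)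
    ?_ K hK ?_ ?_
  · exact (ContDiff.sum fun i _ => (hvi i).pow 2).add (ContDiff.sum fun i _ => (hhi i).pow 2)
  · intro t ht x hx
    simp [hsuppv t ht x hx, hsupph t ht x hx]
  · intro t ht
    have hder : ∀ x, deriv (fun s => (∑ i : Fin 3, (v s x i) ^ 2) + ∑ i : Fin 3, (h s x i) ^ 2) t
        = 2 * ((∑ i, v t x i * deriv (fun s => v s x i) t)
          + ∑ i, h t x i * deriv (fun s => h s x i) t) := by
      intro x
      have h1 := HasDerivAt.fun_sum (u := Finset.univ)
        (fun i _ => ((tv x i) t).hasDerivAt.fun_pow 2)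
      have h2 := HasDerivAt.fun_sum (u := Finset.univ)
        (fun i _ => ((th x i) t).hasDerivAt.fun_pow 2)
      rw [(h1.fun_add h2).deriv]
      simp only [Fin.sum_univ_three]
      push_cast
      ring
    simp only [hder]
    rw [setIntegral_eq_integral_of_forall_compl_eq_zero
      (fun x hx => by simp [hsuppv t ht x hx, hsupph t ht x hx]), integral_const_mul]
    have hpH : ∀ i j, ContDiff ℝ (⊤ : ℕ∞) (pd j (fun y => h t y i)) :=
      fun i j => contDiff_pd j _ (slh t i)
    have := core μ ν hμ hν (fun i y => v t y i) (fun i y => h t y i)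
      (fun i y => cross (curl (h t) y) (h t y) i)
      (fun i x => deriv (fun s => v s x i) t) (fun i x => deriv (fun s => h s x i) t) (P t)
      (slv t) (slh t)
      (by
        intro i
        have a := slh t
        fin_cases i <;> simp [cross, curl] <;> fun_prop)
      (slP t) K hK
      (fun i x hx => by simp [hsuppv t ht x hx]) (fun i x hx => by simp [hsupph t ht x hx])
      (fun x => by simpa [Fin.sum_univ_three] using hdivv t ht x)
      (fun x => by simpa [Fin.sum_univ_three] using hdivh t ht x)
      (fun x => by simp [cross, curl]; ring)
      (fun x i => heqv t ht x i)
      (fun x => heqh t ht x 0) (fun x => heqh t ht x 1) (fun x => heqh t ht x 2)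
    linarith
end
end

section
/- Let T > 0. Let v : [0,T]×ℝ³ → ℝ³ be jointly smooth with v(t,·) divergence-free for each t, with cylindrical components v_r, v_θ, v_z. Let ℋ : [0,T]×ℝ³ → ℝ be jointly smooth, axisymmetric in x for each t, with supp ℋ(t,·) contained in a fixed compact set K ⊂ U for all t, and suppose the equation ∂_t ℋ + v_r ∂_r ℋ + v_z ∂_z ℋ − ℋ·(1/r)∂_θ v_θ − 2ℋ∂_z ℋ = 0 holds on [0,T]×U. Then for every t ∈ [0,T]: ‖ℋ(t,·)‖_{L^∞(ℝ³)} = ‖ℋ(0,·)‖_{L^∞(ℝ³)}. -/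
open MeasureTheory

noncomputable section

/-- Euclidean dot product on `ℝ³` -/
def dot (a b : R3) : ℝ := ∑ j : Fin 3, a j * b j

/-- radial cylindrical component `u_r = u · e_r` -/
def compR (u : R3 → R3) : R3 → ℝ := fun y => dot (u y) (er y)
/-- azimuthal cylindrical component `u_θ = u · e_θ` -/
def compTh (u : R3 → R3) : R3 → ℝ := fun y => dot (u y) (etheta y)
/-- vertical cylindrical component `u_z = u · e_z` -/
def compZ (u : R3 → R3) : R3 → ℝ := fun y => dot (u y) ez

/-- divergence-free vector field -/
def divFree (u : R3 → R3) : Prop := ∀ x : R3, (∑ i : Fin 3, pd i (fun y => u y i) x) = 0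

/-- rotation of `x` around the axis by angle `a` -/
def rotA (x : R3) (a : ℝ) : R3 :=
  ![Real.cos a * x 0 - Real.sin a * x 1, Real.sin a * x 0 + Real.cos a * x 1, x 2]

lemma rr_rotA (x : R3) (a : ℝ) : rr (rotA x a) = rr x := by
  unfold rr rotA
  congr 1
  simp only [Matrix.cons_val_zero, Matrix.cons_val_one]
  linear_combination (x 0 ^ 2 + x 1 ^ 2) * Real.sin_sq_add_cos_sq a

lemma rotA_zero (x : R3) : rotA x 0 = x := by
  ext i; fin_cases i <;> simp [rotA]

lemma rotA_two_pi (x : R3) : rotA x (2 * Real.pi) = x := by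
  ext i; fin_cases i <;> simp [rotA]

lemma hasDerivAt_rotA (x : R3) (a : ℝ) :
    HasDerivAt (rotA x) ((rotA x a 0) • (Pi.single 1 1 : R3) - (rotA x a 1) • (Pi.single 0 1 : R3)) a := by
  rw [hasDerivAt_pi]
  intro i
  have hc := Real.hasDerivAt_cos a
  have hs := Real.hasDerivAt_sin a
  fin_cases i
  · have := (hc.mul_const (x 0)).sub (hs.mul_const (x 1))
    refine this.congr_deriv ?_
    simp [rotA]
    try ring
  · have := (hs.mul_const (x 0)).add (hc.mul_const (x 1))
    refine this.congr_deriv ?_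
    simp [rotA]
    try ring
  · simpa [rotA] using hasDerivAt_const a (x 2)

lemma hasDerivAt_comp_rotA (u : R3 → ℝ) (x : R3) (a : ℝ) (hu : DifferentiableAt ℝ u (rotA x a)) :
    HasDerivAt (fun b => u (rotA x b)) (dTheta u (rotA x a)) a := by
  have := hu.hasFDerivAt.comp_hasDerivAt a (hasDerivAt_rotA x a)
  rw [map_sub, map_smul, map_smul] at this
  exact this

lemma diff_compTh (w : R3 → R3) (hw : Differentiable ℝ w) (x : R3) (hx : x ∈ U) :
    DifferentiableAt ℝ (compTh w) x := by
  have hx' : 0 < rr x := hx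
  have hpos : x 0 ^ 2 + x 1 ^ 2 ≠ 0 := by
    unfold rr at hx'
    exact (Real.sqrt_pos.1 hx').ne'
  have hr : DifferentiableAt ℝ rr x := by
    unfold rr
    have hp : DifferentiableAt ℝ (fun y : R3 => y 0 ^ 2 + y 1 ^ 2) x := by fun_prop
    exact hp.sqrt hpos
  have h0 : ∀ i, DifferentiableAt ℝ (fun y => w y i) x := fun i => by
    have := hw x
    fun_prop
  have e : compTh w = fun y => w y 0 * (-(y 1) / rr y) + w y 1 * (y 0 / rr y) := by
    ext y
    simp [compTh, dot, etheta, Fin.sum_univ_three]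
  rw [e]
  have hne := hx'.ne'
  have q0 : DifferentiableAt ℝ (fun y : R3 => y 0 / rr y) x := by
    have h : DifferentiableAt ℝ (fun y : R3 => y 0) x := by fun_prop
    simpa only [div_eq_mul_inv] using h.fun_mul (hr.fun_inv hne)
  have q1 : DifferentiableAt ℝ (fun y : R3 => -(y 1) / rr y) x := by
    have h : DifferentiableAt ℝ (fun y : R3 => -(y 1)) x := by fun_prop
    simpa only [div_eq_mul_inv] using h.fun_mul (hr.fun_inv hne)
  exact ((h0 0).mul q1).add ((h0 1).mul q0)

lemma touch_le (M : ℝ → ℝ) (hM : Continuous M) (a b : ℝ) (hab : a ≤ b)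
    (h : ∀ t ∈ Set.Icc a b, ∃ φ : ℝ → ℝ, HasDerivAt φ 0 t ∧ φ t = M t ∧
      ∀ s ∈ Set.Icc a b, φ s ≤ M s) : M a ≤ M b := by
  have key := image_le_of_liminf_slope_right_le_deriv_boundary
    (f := fun s => - M s) (a := a) (b := b) hM.neg.continuousOn
    (B := fun _ => - M a) (B' := fun _ => 0) le_rfl continuousOn_const
    (fun x _ => hasDerivWithinAt_const _ _ _) ?_ (Set.right_mem_Icc.2 hab)
  · simpa using key
  · intro t ht r hr
    obtain ⟨φ, hφ, hφt, hle⟩ := h t ⟨ht.1, ht.2.le⟩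
    apply Filter.Eventually.frequently
    have h1 := hφ.neg.hasDerivWithinAt (s := Set.Ioi t)
    rw [hasDerivWithinAt_iff_tendsto_slope' (by simp)] at h1
    have h2 := h1.eventually_lt_const (u := r) (by simpa using hr)
    have h3 : ∀ᶠ z in nhdsWithin t (Set.Ioi t), z ∈ Set.Ioo t b := Ioo_mem_nhdsGT ht.2
    filter_upwards [h2, h3] with z hz1 hz2
    refine lt_of_le_of_lt ?_ hz1
    rw [slope_def_field, slope_def_field]
    have := hle z ⟨ht.1.trans hz2.1.le, hz2.2.le⟩
    have hp : 0 < z - t := sub_pos.2 hz2.1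
    apply div_le_div_of_nonneg_right _ hp.le
    simp only [Pi.neg_apply]
    linarith

lemma touch_eq (M : ℝ → ℝ) (hM : Continuous M) (a b : ℝ) (hab : a ≤ b)
    (h : ∀ t ∈ Set.Icc a b, ∃ φ : ℝ → ℝ, HasDerivAt φ 0 t ∧ φ t = M t ∧
      ∀ s ∈ Set.Icc a b, φ s ≤ M s) : M b = M a := by
  apply le_antisymm _ (touch_le M hM a b hab h)
  have := touch_le (fun s => M (a + b - s)) (by fun_prop) a b hab ?_
  · simpa using this
  · intro t ht
    obtain ⟨φ, h1, h2, h3⟩ := h (a + b - t) ⟨by linarith [ht.2], by linarith [ht.1]⟩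
    refine ⟨fun s => φ (a + b - s), ?_, h2, fun s hs => h3 _ ⟨by linarith [hs.2], by linarith [hs.1]⟩⟩
    have := HasDerivAt.comp_const_sub (a + b) t h1
    simpa using this

lemma le_eLpNorm_top (f : R3 → ℝ) (hf : Continuous f) (x : R3) :
    ‖f x‖ₑ ≤ eLpNorm f ⊤ volume := by
  rw [eLpNorm_exponent_top]
  have h := ae_le_eLpNormEssSup (f := f) (μ := (volume : Measure R3))
  have hd := Measure.dense_of_ae h
  have hc : IsClosed {y | ‖f y‖ₑ ≤ eLpNormEssSup f volume} :=
    isClosed_le (by fun_prop) continuous_const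
  have := hc.closure_eq ▸ hd x
  exact this

lemma eLpNorm_top_le (f g : R3 → ℝ) (hg : Continuous g) (h : ∀ x, ∃ y, |f x| ≤ |g y|) :
    eLpNorm f ⊤ volume ≤ eLpNorm g ⊤ volume := by
  rw [eLpNorm_exponent_top (f := f)]
  refine essSup_le_of_ae_le _ ?_
  apply Filter.Eventually.of_forall
  intro x
  obtain ⟨y, hy⟩ := h x
  refine le_trans ?_ (le_eLpNorm_top g hg y)
  rw [enorm_le_iff_norm_le]
  exact hy

/-- `L^∞` conservation of the good unknown `ℋ`. -/
theorem stmt_15 (T : ℝ) (hT : 0 < T) (v : ℝ → R3 → R3)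
    (hv : ContDiff ℝ (⊤ : ℕ∞) (fun p : ℝ × R3 => v p.1 p.2))
    (hdiv : ∀ t ∈ Set.Icc (0 : ℝ) T, divFree (v t))
    (H : ℝ → R3 → ℝ)
    (hH : ContDiff ℝ (⊤ : ℕ∞) (fun p : ℝ × R3 => H p.1 p.2))
    (hax : ∀ t ∈ Set.Icc (0 : ℝ) T, axisym (H t))
    (K : Set R3) (hK : IsCompact K) (hKU : K ⊆ U)
    (hsupp : ∀ t ∈ Set.Icc (0 : ℝ) T, ∀ x ∉ K, H t x = 0)
    (heq : ∀ t ∈ Set.Icc (0 : ℝ) T, ∀ x ∈ U,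
      deriv (fun s => H s x) t
        + compR (v t) x * dR (H t) x + compZ (v t) x * dZ (H t) x
        - H t x * (dTheta (compTh (v t)) x / rr x)
        - 2 * H t x * dZ (H t) x = 0) :
    ∀ t ∈ Set.Icc (0 : ℝ) T,
      eLpNorm (H t) ⊤ volume = eLpNorm (H 0) ⊤ volume := by
  have hHt : ∀ t, Differentiable ℝ (H t) := fun t => by
    have h1 : Differentiable ℝ (fun p : ℝ × R3 => H p.1 p.2) := hH.differentiable (by simp)
    have h2 : Differentiable ℝ (fun x : R3 => ((t, x) : ℝ × R3)) := by fun_prop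
    exact h1.comp h2
  have hvt : ∀ t, Differentiable ℝ (v t) := fun t => by
    have h1 : Differentiable ℝ (fun p : ℝ × R3 => v p.1 p.2) := hv.differentiable (by simp)
    have h2 : Differentiable ℝ (fun x : R3 => ((t, x) : ℝ × R3)) := by fun_prop
    exact h1.comp h2
  have hHs : ∀ x, Differentiable ℝ (fun s => H s x) := fun x => by
    have h1 : Differentiable ℝ (fun p : ℝ × R3 => H p.1 p.2) := hH.differentiable (by simp)
    have h2 : Differentiable ℝ (fun t : ℝ => ((t, x) : ℝ × R3)) := by fun_prop
    exact h1.comp h2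
  have hF : Continuous (fun p : ℝ × R3 => (H p.1 p.2) ^ 2) := hH.continuous.pow 2
  -- the empty case
  rcases K.eq_empty_or_nonempty with hKe | hKn
  · intro t ht
    have e1 : H t = 0 := by ext x; exact hsupp t ht x (by simp [hKe])
    have e2 : H 0 = 0 := by
      ext x; exact hsupp 0 (Set.left_mem_Icc.2 hT.le) x (by simp [hKe])
    rw [e1, e2]
  set M : ℝ → ℝ := fun t => sSup ((fun x => (H t x) ^ 2) '' K) with hMdef
  have hMc : Continuous M :=
    hK.continuous_sSup (f := fun t x => (H t x) ^ 2) hF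
  have hFt : ∀ t, Continuous (fun x => (H t x) ^ 2) := fun t => (hHt t).continuous.pow 2
  have hle : ∀ t, ∀ x ∈ K, (H t x) ^ 2 ≤ M t := fun t x hx =>
    le_csSup (hK.bddAbove_image (hFt t).continuousOn) (Set.mem_image_of_mem _ hx)
  have hex : ∀ t, ∃ x ∈ K, M t = (H t x) ^ 2 := fun t =>
    hK.exists_sSup_image_eq hKn (hFt t).continuousOn
  have hM0 : ∀ t, 0 ≤ M t := fun t => by
    obtain ⟨x, _, h⟩ := hex t
    rw [h]; positivity
  have hle' : ∀ t ∈ Set.Icc (0 : ℝ) T, ∀ x, (H t x) ^ 2 ≤ M t := fun t ht x => by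
    by_cases hx : x ∈ K
    · exact hle t x hx
    · rw [hsupp t ht x hx]; simpa using hM0 t
  have htouch : ∀ t ∈ Set.Icc (0 : ℝ) T, ∃ φ : ℝ → ℝ, HasDerivAt φ 0 t ∧ φ t = M t ∧
      ∀ s ∈ Set.Icc (0 : ℝ) T, φ s ≤ M s := by
    intro t ht
    obtain ⟨x, hxK, hx⟩ := hex t
    by_cases hz : H t x = 0
    · refine ⟨fun s => (H s x) ^ 2, ?_, hx.symm, fun s _ => hle s x hxK⟩
      have := ((hHs x t).hasDerivAt).pow 2
      exact this.congr_deriv (by simp [hz])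
    have hxU : ∀ a, rotA x a ∈ U := fun a => by
      change 0 < rr (rotA x a)
      rw [rr_rotA]; exact hKU hxK
    -- a zero of the angular derivative on the orbit
    obtain ⟨a, -, ha⟩ := exists_hasDerivAt_eq_zero (f := fun b => compTh (v t) (rotA x b))
      (f' := fun b => dTheta (compTh (v t)) (rotA x b)) Real.two_pi_pos
      (fun b _ => ((hasDerivAt_comp_rotA _ x b
        (diff_compTh _ (hvt t) _ (hxU b))).continuousAt).continuousWithinAt)
      (by simp only [rotA_zero, rotA_two_pi])
      (fun b _ => hasDerivAt_comp_rotA _ x b (diff_compTh _ (hvt t) _ (hxU b)))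
    have hrot : H t (rotA x a) = H t x := by
      have hd : ∀ b, HasDerivAt (fun b => H t (rotA x b)) 0 b := fun b => by
        have := hasDerivAt_comp_rotA (H t) x b (hHt t _)
        rwa [hax t ht _ (hxU b)] at this
      have := is_const_of_deriv_eq_zero (fun b => (hd b).differentiableAt)
        (fun b => (hd b).deriv) a 0
      simpa only [rotA_zero] using this
    set y := rotA x a with hy
    have hyz : H t y ≠ 0 := by rwa [hrot]
    have hyK : y ∈ K := by
      by_contra hn
      exact hyz (hsupp t ht y hn)
    have hmax : IsLocalMax (fun z => (H t z) ^ 2) y := by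
      apply Filter.Eventually.of_forall
      intro z
      simp only [hrot, ← hx]
      exact hle' t ht z
    have hfd : fderiv ℝ (H t) y = 0 := by
      have h1 := hmax.hasFDerivAt_eq_zero (((hHt t) y).hasFDerivAt.pow 2)
      have h2 : (2 * H t y) ≠ 0 := mul_ne_zero two_ne_zero hyz
      ext w
      have h3 := congrArg (fun L => L w) h1
      simp [hyz] at h3
      simpa using h3
    have hpd : ∀ i, pd i (H t) y = 0 := fun i => by simp [pd, hfd]
    have hE := heq t ht y (hxU a)
    have hder : deriv (fun s => H s y) t = 0 := by
      simp only [ha, dR, dZ, hpd] at hE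
      simpa using hE
    refine ⟨fun s => (H s y) ^ 2, ?_, by simp only [hrot, hx], fun s _ => hle s y hyK⟩
    have := ((hHs y t).hasDerivAt).pow 2
    exact this.congr_deriv (by simp [hder])
  intro t ht
  have hMt : M t = M 0 := touch_eq M hMc 0 t ht.1 (fun s hs => by
    obtain ⟨φ, h1, h2, h3⟩ := htouch s ⟨hs.1, hs.2.trans ht.2⟩
    exact ⟨φ, h1, h2, fun s' hs' => h3 s' ⟨hs'.1, hs'.2.trans ht.2⟩⟩)
  have h0 : (0 : ℝ) ∈ Set.Icc 0 T := Set.left_mem_Icc.2 hT.le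
  have hcmp : ∀ p ∈ Set.Icc (0 : ℝ) T, ∀ q, M p = M q → ∀ x, ∃ y, |H p x| ≤ |H q y| := by
    intro p hp q hpq x
    obtain ⟨y, _, hy⟩ := hex q
    refine ⟨y, ?_⟩
    rw [← sq_le_sq, ← hy, ← hpq]
    exact hle' p hp x
  exact le_antisymm
    (eLpNorm_top_le _ _ (hHt 0).continuous (hcmp t ht 0 hMt))
    (eLpNorm_top_le _ _ (hHt t).continuous (hcmp 0 h0 t hMt.symm))
end
end
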